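/- Let y_1, …, y_n ∈ Y be fixed points with a_k := −∑_{i=1}^n log p_k(y_i) > 0 for each k = 1, …, K, and let ỹ_1, …, ỹ_n be i.i.d. with law Q. Define the random quantities op_k = ∑_{i=1}^n log p_k(y_i) − ∑_{i=1}^n log p_k(ỹ_i), m_k = (−∑_{i=1}^n log p_k(ỹ_i))/a_k, m = min_k m_k, and w^op_k = exp(−op_k)/∑_j exp(−op_j). Assume m > 1 almost surely, assume E_Q[log p_k(y)] is finite for each k, and assume φ_term = log( (1/K) ∑_{k=1}^K E[ exp( ∑_{i=1}^n log p_k(ỹ_i) − n·E_Q[log p_k(y)] ) ] ) is finite. Then for any δ ∈ (0, 1], with probability at least 1 − δ, simultaneously for all w^p ∈ S^K: n·E_Q[−log ∑_{k=1}^K w^p_k p_k(y)] ≤ (m/(m−1))·∑_{k=1}^K w^p_k log(w^p_k / w^op_k) − (1/(m−1))·∑_{k=1}^K w^p_k log w^p_k + log K − (m/(m−1))·log ∑_{k=1}^K exp(−op_k) − log δ + φ_term. -/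

import Mathlib

open MeasureTheory

/-- The optimism of model `k`: its in-sample log score on the training points minus its
log score on the fresh sample `ys`. -/
noncomputable def optimism {Y : Type*} {K n : ℕ} (p : Fin K → Y → ℝ)
    (ytrain : Fin n → Y) (ys : Fin n → Y) (k : Fin K) : ℝ :=
  (∑ i : Fin n, Real.log (p k (ytrain i))) - (∑ i : Fin n, Real.log (p k (ys i)))

/-- The minimal overfitting ratio `m = minₖ (−∑ᵢ log pₖ(ỹᵢ)) / (−∑ᵢ log pₖ(yᵢ))`. -/
noncomputable def minOverfitRatio {Y : Type*} {K n : ℕ} (p : Fin K → Y → ℝ)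
    (ytrain : Fin n → Y) (ys : Fin n → Y) : ℝ :=
  ⨅ k : Fin K, (-(∑ i : Fin n, Real.log (p k (ys i)))) /
    (-(∑ i : Fin n, Real.log (p k (ytrain i))))

/-- Finite Donsker-Varadhan inequality. -/
theorem dv_finite {K : ℕ} (w X : Fin K → ℝ) (hw : ∀ k, 0 ≤ w k) (hs : ∑ k, w k = 1)
    (Z : ℝ) (hZ : Z = ∑ k, Real.exp (X k)) (hZ0 : 0 < Z) :
    ∑ k, w k * X k ≤ ∑ k, w k * Real.log (w k) + Real.log Z := by
  have key : ∀ k, w k * X k - w k * Real.log (w k) - w k * Real.log Z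
      ≤ Real.exp (X k) / Z - w k := by
    intro k
    rcases (hw k).eq_or_lt with h | h
    · rw [← h]
      have : 0 < Real.exp (X k) / Z := div_pos (Real.exp_pos _) hZ0
      simpa using this.le
    · have h1 := Real.log_le_sub_one_of_pos (x := Real.exp (X k) / (Z * w k))
        (div_pos (Real.exp_pos _) (mul_pos hZ0 h))
      rw [Real.log_div (Real.exp_pos _).ne' (mul_pos hZ0 h).ne', Real.log_exp,
        Real.log_mul hZ0.ne' h.ne'] at h1
      have h2 := mul_le_mul_of_nonneg_left h1 h.le
      have h3 : w k * (Real.exp (X k) / (Z * w k) - 1) = Real.exp (X k) / Z - w k := by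
        field_simp
      rw [h3] at h2
      linarith
  have h := Finset.sum_le_sum (fun k (_ : k ∈ Finset.univ) => key k)
  simp only [Finset.sum_sub_distrib] at h
  rw [← Finset.sum_div, ← hZ, div_self hZ0.ne', ← Finset.sum_mul, hs] at h
  linarith

theorem mix_log_lower {K : ℕ} (w q : Fin K → ℝ) (hw : ∀ k, 0 ≤ w k) (hs : ∑ k, w k = 1)
    (hq : ∀ k, 0 < q k) : ∑ k, w k * Real.log (q k) ≤ Real.log (∑ k, w k * q k) := by
  have := strictConcaveOn_log_Ioi.concaveOn.le_map_sum (t := Finset.univ) (w := w) (p := q)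
    (fun k _ => hw k) hs (fun k _ => hq k)
  simpa [smul_eq_mul] using this

theorem mix_pos {K : ℕ} (w q : Fin K → ℝ) (hw : ∀ k, 0 ≤ w k) (hs : ∑ k, w k = 1)
    (hq : ∀ k, 0 < q k) : 0 < ∑ k, w k * q k := by
  have h0 : 0 ≤ ∑ k, w k * q k := Finset.sum_nonneg fun k _ => mul_nonneg (hw k) (hq k).le
  rcases h0.eq_or_lt with h | h
  · exfalso
    have h1 := (Finset.sum_eq_zero_iff_of_nonneg
      (fun k _ => mul_nonneg (hw k) (hq k).le)).1 h.symm
    have h2 : ∑ k, w k = 0 := Finset.sum_eq_zero fun k hk =>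
      (mul_eq_zero.1 (h1 k hk)).resolve_right (hq k).ne'
    linarith
  · exact h

theorem mix_log_upper {K : ℕ} (w q : Fin K → ℝ) (hw : ∀ k, 0 ≤ w k) (hs : ∑ k, w k = 1)
    (hq : ∀ k, 0 < q k) : Real.log (∑ k, w k * q k) ≤ ∑ k, |Real.log (q k)| := by
  rw [Real.log_le_iff_le_exp (mix_pos w q hw hs hq)]
  calc ∑ k, w k * q k ≤ ∑ k, w k * Real.exp (∑ k, |Real.log (q k)|) := by
        refine Finset.sum_le_sum fun k _ => mul_le_mul_of_nonneg_left ?_ (hw k)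
        rw [← Real.log_le_iff_le_exp (hq k)]
        exact (le_abs_self _).trans
          (Finset.single_le_sum (f := fun k => |Real.log (q k)|)
            (fun i _ => abs_nonneg _) (Finset.mem_univ k))
    _ = _ := by rw [← Finset.sum_mul, hs, one_mul]

theorem mix_integral {Y : Type*} [MeasurableSpace Y] (Q : Measure Y)
    {K : ℕ} (p : Fin K → Y → ℝ)
    (hmeas : ∀ k, Measurable (p k)) (hpos : ∀ k y, 0 < p k y)
    (hint : ∀ k, Integrable (fun y => Real.log (p k y)) Q)
    (w : Fin K → ℝ) (hw : ∀ k, 0 ≤ w k) (hs : ∑ k, w k = 1) :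
    ∫ y, -Real.log (∑ k, w k * p k y) ∂Q ≤ -∑ k, w k * ∫ y, Real.log (p k y) ∂Q := by
  have hlow : Integrable (fun y => ∑ k, w k * Real.log (p k y)) Q :=
    integrable_finsetSum _ fun k _ => (hint k).const_mul _
  have hup : Integrable (fun y => ∑ k, |Real.log (p k y)|) Q :=
    integrable_finsetSum _ fun k _ => (hint k).abs
  have hI : Integrable (fun y => Real.log (∑ k, w k * p k y)) Q := by
    refine integrable_of_le_of_le ?_ (Filter.Eventually.of_forall fun y => ?_)
      (Filter.Eventually.of_forall fun y => ?_) hlow hup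
    · have : Measurable fun y => Real.log (∑ k, w k * p k y) :=
        Real.measurable_log.comp (Finset.measurable_sum _ fun k _ => (hmeas k).const_mul _)
      exact this.aestronglyMeasurable
    · exact mix_log_lower w _ hw hs fun k => hpos k y
    · exact mix_log_upper w _ hw hs fun k => hpos k y
  rw [integral_neg]
  have h := integral_mono hlow hI (fun y => mix_log_lower w _ hw hs fun k => hpos k y)
  rw [integral_finsetSum _ fun k _ => (hint k).const_mul _] at h
  simp only [integral_const_mul] at h
  linarith

/-- **Theorem 3.4, the second inequality bound.** Without tail
assumptions on the models, with probability at least `1 − δ` over the fresh i.i.d. sample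
`ỹ₁, …, ỹₙ ~ Q`, simultaneously for all posterior probability vectors `w^p`:
`n·E_Q[−log ∑ₖ w^pₖ pₖ] ≤ (m/(m−1))·KL(w^p‖w^op) − (1/(m−1))·∑ₖ w^pₖ log w^pₖ + log K
− (m/(m−1))·log ∑ₖ exp(−opₖ) − log δ + φ_term`. -/
theorem second_inequality_bound
    {Y : Type*} [MeasurableSpace Y] (Q : Measure Y) [IsProbabilityMeasure Q]
    (K : ℕ) (hK : 1 ≤ K) (p : Fin K → Y → ℝ)
    (hmeas : ∀ k, Measurable (p k)) (hpos : ∀ k y, 0 < p k y)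
    (n : ℕ) (hn : 1 ≤ n) (ytrain : Fin n → Y)
    (ha_pos : ∀ k, 0 < -(∑ i : Fin n, Real.log (p k (ytrain i))))
    (hm : ∀ᵐ ys ∂(Measure.pi fun _ : Fin n => Q), 1 < minOverfitRatio p ytrain ys)
    (hint : ∀ k, Integrable (fun y => Real.log (p k y)) Q)
    (hφint : ∀ k, Integrable
      (fun ys : Fin n → Y => Real.exp
        ((∑ i : Fin n, Real.log (p k (ys i))) - (n : ℝ) * ∫ y, Real.log (p k y) ∂Q))
      (Measure.pi fun _ : Fin n => Q))
    (φterm : ℝ)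
    (hφ_def : φterm = Real.log ((1 / (K : ℝ)) * ∑ k, ∫ ys : Fin n → Y,
      Real.exp ((∑ i : Fin n, Real.log (p k (ys i)))
        - (n : ℝ) * ∫ y, Real.log (p k y) ∂Q) ∂(Measure.pi fun _ : Fin n => Q)))
    (δ : ℝ) (hδ0 : 0 < δ) (hδ1 : δ ≤ 1) :
    ENNReal.ofReal (1 - δ) ≤
      (Measure.pi fun _ : Fin n => Q)
        {ys : Fin n → Y | ∀ wp : Fin K → ℝ, (∀ k, 0 ≤ wp k) → (∑ k, wp k = 1) →
          (n : ℝ) * (∫ y, -Real.log (∑ k, wp k * p k y) ∂Q) ≤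
            (minOverfitRatio p ytrain ys / (minOverfitRatio p ytrain ys - 1)) *
                (∑ k, wp k * Real.log (wp k /
                  (Real.exp (-(optimism p ytrain ys k)) /
                    ∑ j, Real.exp (-(optimism p ytrain ys j)))))
              - (1 / (minOverfitRatio p ytrain ys - 1)) * (∑ k, wp k * Real.log (wp k))
              + Real.log K
              - (minOverfitRatio p ytrain ys / (minOverfitRatio p ytrain ys - 1)) *
                  Real.log (∑ k, Real.exp (-(optimism p ytrain ys k)))
              - Real.log δ + φterm} := by
  set μ : Measure (Fin n → Y) := Measure.pi fun _ : Fin n => Q with hμ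
  set c : Fin K → ℝ := fun k => ∫ y, Real.log (p k y) ∂Q with hc
  set X : Fin K → (Fin n → Y) → ℝ := fun k ys =>
    (∑ i : Fin n, Real.log (p k (ys i))) - (n : ℝ) * c k with hX
  have hKpos : (0 : ℝ) < K := by exact_mod_cast hK
  haveI : Nonempty (Fin K) := ⟨⟨0, hK⟩⟩
  set G : (Fin n → Y) → ℝ := fun ys => ∑ k, Real.exp (X k ys) with hG
  have hGpos : ∀ ys, 0 < G ys := fun ys =>
    Finset.sum_pos (fun k _ => Real.exp_pos _) Finset.univ_nonempty
  have hGint : Integrable G μ := integrable_finsetSum _ fun k _ => hφint k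
  set E : ℝ := ∑ k, ∫ ys, Real.exp (X k ys) ∂μ with hE
  have hGE : ∫ ys, G ys ∂μ = E := integral_finsetSum _ fun k _ => hφint k
  have hEpos : 0 < E :=
    Finset.sum_pos (fun k _ => integral_exp_pos (hφint k)) Finset.univ_nonempty
  have hφ : φterm = Real.log E - Real.log K := by
    rw [hφ_def, one_div, Real.log_mul (inv_pos.2 hKpos).ne' hEpos.ne', Real.log_inv]
    ring
  have hXm : ∀ k, Measurable (X k) := fun k =>
    (Finset.measurable_sum _ fun i _ =>
      Real.measurable_log.comp ((hmeas k).comp (measurable_pi_apply i))).sub_const _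
  have hGm : Measurable G :=
    Finset.measurable_sum _ fun k _ => Real.measurable_exp.comp (hXm k)
  have hmarkov : μ.real {ys | E / δ ≤ G ys} ≤ δ := by
    have h := mul_meas_ge_le_integral_of_nonneg
      (Filter.Eventually.of_forall fun ys => (hGpos ys).le) hGint (E / δ)
    rw [hGE] at h
    have h2 : E * μ.real {ys | E / δ ≤ G ys} ≤ E * δ := by
      have := mul_le_mul_of_nonneg_right h hδ0.le
      calc _ = E / δ * μ.real {ys | E / δ ≤ G ys} * δ := by field_simp
        _ ≤ _ := this
    exact le_of_mul_le_mul_left h2 hEpos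
  have hbad : MeasurableSet {ys | E / δ ≤ G ys} := measurableSet_le measurable_const hGm
  have hgood : ENNReal.ofReal (1 - δ) ≤ μ {ys | E / δ ≤ G ys}ᶜ := by
    rw [← ofReal_measureReal, probReal_compl_eq_one_sub hbad]
    exact ENNReal.ofReal_le_ofReal (by linarith)
  refine hgood.trans (measure_mono_ae ?_)
  filter_upwards [hm] with ys hm1 hys wp hw hs
  have hys' : G ys < E / δ := not_le.1 hys
  have hJ := mix_integral Q p hmeas hpos hint wp hw hs
  have hDV := dv_finite wp (fun k => X k ys) hw hs (G ys) rfl (hGpos ys)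
  have hlogG : Real.log (G ys) ≤ Real.log E - Real.log δ := by
    rw [← Real.log_div hEpos.ne' hδ0.ne']
    exact Real.log_le_log (hGpos ys) hys'.le
  have hmk : ∀ k, minOverfitRatio p ytrain ys ≤ (-(∑ i : Fin n, Real.log (p k (ys i)))) /
      (-(∑ i : Fin n, Real.log (p k (ytrain i)))) :=
    fun k => ciInf_le (Set.finite_range _).bddBelow k
  set m := minOverfitRatio p ytrain ys with hmdef
  have hm0 : 0 < m - 1 := by linarith
  have hL : ∀ k, -(∑ i : Fin n, Real.log (p k (ys i))) ≤
      m / (m - 1) * optimism p ytrain ys k := by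
    intro k
    have h := (le_div_iff₀ (ha_pos k)).1 (hmk k)
    rw [div_mul_eq_mul_div, le_div_iff₀ hm0]
    unfold optimism
    linarith
  set Z := ∑ j, Real.exp (-(optimism p ytrain ys j)) with hZ
  have hZpos : 0 < Z := Finset.sum_pos (fun k _ => Real.exp_pos _) Finset.univ_nonempty
  have hKL : ∑ k, wp k * Real.log (wp k / (Real.exp (-(optimism p ytrain ys k)) / Z)) =
      ∑ k, wp k * Real.log (wp k) + ∑ k, wp k * optimism p ytrain ys k + Real.log Z := by
    have : ∀ k, wp k * Real.log (wp k / (Real.exp (-(optimism p ytrain ys k)) / Z)) =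
        wp k * Real.log (wp k) + wp k * optimism p ytrain ys k + wp k * Real.log Z := by
      intro k
      rcases (hw k).eq_or_lt with h | h
      · simp [← h]
      · rw [Real.log_div h.ne' (div_pos (Real.exp_pos _) hZpos).ne',
          Real.log_div (Real.exp_pos _).ne' hZpos.ne', Real.log_exp]
        ring
    rw [Finset.sum_congr rfl fun k _ => this k, Finset.sum_add_distrib,
      Finset.sum_add_distrib, ← Finset.sum_mul, hs, one_mul]
  rw [hKL, hφ]
  have hLs : ∑ k, wp k * -(∑ i : Fin n, Real.log (p k (ys i))) ≤
      m / (m - 1) * ∑ k, wp k * optimism p ytrain ys k := by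
    rw [Finset.mul_sum]
    refine Finset.sum_le_sum fun k _ => ?_
    have := mul_le_mul_of_nonneg_left (hL k) (hw k)
    linarith
  have hXs : ∑ k, wp k * X k ys =
      -(∑ k, wp k * -(∑ i : Fin n, Real.log (p k (ys i)))) - n * ∑ k, wp k * c k := by
    rw [Finset.mul_sum, ← Finset.sum_neg_distrib, ← Finset.sum_sub_distrib]
    refine Finset.sum_congr rfl fun k _ => ?_
    simp only [hX]
    ring
  rw [hXs] at hDV
  have hJn := mul_le_mul_of_nonneg_left hJ (Nat.cast_nonneg (α := ℝ) n)
  have hfrac : m / (m - 1) = 1 + 1 / (m - 1) := by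
    field_simp
    ring
  set A := ∑ k, wp k * Real.log (wp k)
  set B := ∑ k, wp k * optimism p ytrain ys k
  have hR : m / (m - 1) * (A + B + Real.log Z) - 1 / (m - 1) * A + Real.log K
      - m / (m - 1) * Real.log Z - Real.log δ + (Real.log E - Real.log K)
      = A + m / (m - 1) * B - Real.log δ + Real.log E := by
    rw [hfrac]
    ring
  rw [hR]
  linarith
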